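/- Suppose spt μ ⊂ S(-1,c) and spt ν ⊂ S(c,1) for some c ∈ (-1,1), with μ, ν probability measures on S^d giving zero mass to horizontal slices. Choose ε₁, ε₂ > 0 with μ[S(-1,-1+ε₁)] = ν[S(c,c+ε₂)] = 1/2, and set μ⁻ = μ|_{S(-1,-1+ε₁)}, μ⁺ = μ|_{S(-1+ε₁,c)}, ν⁻ = ν|_{S(c,c+ε₂)}, ν⁺ = ν|_{S(c+ε₂,1)}. Then γ := 2(μ⁻ ⊗ ν⁻ + μ⁺ ⊗ ν⁺) is a coupling of μ and ν, and |x - y| ≥ min{c+1-ε₁, ε₂} > 0 for all (x,y) ∈ spt γ. -/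

import Mathlib

open MeasureTheory

/-- The slab `S(a,b) = {x ∈ S^d : a ≤ x_{d+1} ≤ b}` on the unit sphere. -/
def slab (d : ℕ) (a b : ℝ) : Set (EuclideanSpace ℝ (Fin (d + 1))) :=
  {x | ‖x‖ = 1 ∧ a ≤ x (Fin.last d) ∧ x (Fin.last d) ≤ b}

/-- The (closed) support of a measure. -/
def measSupport {α : Type*} [TopologicalSpace α] [MeasurableSpace α]
    (γ : Measure α) : Set α :=
  {x | ∀ U : Set α, IsOpen U → x ∈ U → 0 < γ U}

lemma slab_meas (d : ℕ) (a b : ℝ) : MeasurableSet (slab d a b) := by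
  apply IsClosed.measurableSet
  unfold slab
  have h1 : Continuous fun x : EuclideanSpace ℝ (Fin (d + 1)) => x (Fin.last d) := by fun_prop
  exact (isClosed_eq continuous_norm continuous_const).inter
    ((isClosed_le continuous_const h1).inter (isClosed_le h1 continuous_const))

lemma slab_lt (d : ℕ) (μ : Measure (EuclideanSpace ℝ (Fin (d + 1)))) [IsProbabilityMeasure μ]
    (a b e : ℝ) (hspt : μ (slab d a e)ᶜ = 0)
    (hhalf : μ (slab d a b) = 1 / 2) : b < e := by
  by_contra! h
  have h1 : μ (slab d a e) = 1 := (prob_compl_eq_zero_iff (slab_meas d a e)).1 hspt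
  have h2 : μ (slab d a e) ≤ μ (slab d a b) :=
    measure_mono fun x hx => ⟨hx.1, hx.2.1, hx.2.2.trans h⟩
  rw [h1, hhalf, one_div] at h2
  exact absurd h2 (not_le.2 (ENNReal.inv_lt_one.2 (by norm_num)))

lemma slab_split (d : ℕ) (μ : Measure (EuclideanSpace ℝ (Fin (d + 1)))) [IsProbabilityMeasure μ]
    (a b e : ℝ)
    (hslice : ∀ t : ℝ, μ {x | ‖x‖ = 1 ∧ x (Fin.last d) = t} = 0)
    (hspt : μ (slab d a e)ᶜ = 0)
    (hhalf : μ (slab d a b) = 1 / 2) :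
    μ.restrict (slab d a b) + μ.restrict (slab d b e) = μ ∧ μ (slab d b e) = 1 / 2 := by
  have hd : AEDisjoint μ (slab d a b) (slab d b e) := by
    refine measure_mono_null ?_ (hslice b)
    intro x hx
    exact ⟨hx.1.1, le_antisymm hx.1.2.2 hx.2.2.1⟩
  have h1 : μ.restrict (slab d a b) + μ.restrict (slab d b e) = μ := by
    rw [← Measure.restrict_union₀ hd (slab_meas d b e).nullMeasurableSet]
    apply Measure.restrict_eq_self_of_ae_mem
    have : ∀ᵐ x ∂μ, x ∈ slab d a e := hspt
    filter_upwards [this] with x hx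
    rcases le_total (x (Fin.last d)) b with h | h
    · exact Or.inl ⟨hx.1, hx.2.1, h⟩
    · exact Or.inr ⟨hx.1, h, hx.2.2⟩
  refine ⟨h1, ?_⟩
  have h2 := congrArg (fun m => m Set.univ) h1
  simp only [Measure.add_apply, Measure.restrict_apply_univ, hhalf, measure_univ] at h2
  have h3 : (1 / 2 : ENNReal) + μ (slab d b e) = 1 / 2 + 1 / 2 := by
    rw [h2, ENNReal.add_halves]
  exact (ENNReal.add_right_inj (by simp)).1 h3

lemma slab_dist (d : ℕ) (x y : EuclideanSpace ℝ (Fin (d + 1))) :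
    y (Fin.last d) - x (Fin.last d) ≤ ‖x - y‖ := by
  have h := PiLp.norm_apply_le (x - y) (Fin.last d)
  rw [PiLp.sub_apply, Real.norm_eq_abs, abs_sub_comm] at h
  exact (le_abs_self _).trans h

lemma slab_prod_null (d : ℕ) (μ ν : Measure (EuclideanSpace ℝ (Fin (d + 1))))
    [IsProbabilityMeasure μ] [IsProbabilityMeasure ν] (a b e f m : ℝ) (h : m ≤ e - b) :
    ((μ.restrict (slab d a b)).prod (ν.restrict (slab d e f))) {q | ‖q.1 - q.2‖ < m} = 0 := by
  rw [Measure.prod_restrict, Measure.restrict_apply' ((slab_meas d a b).prod (slab_meas d e f))]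
  convert measure_empty (μ := μ.prod ν)
  ext q
  simp only [Set.mem_inter_iff, Set.mem_setOf_eq, Set.mem_prod, Set.mem_empty_iff_false,
    iff_false]
  rintro ⟨h1, h2, h3⟩
  have := slab_dist d q.1 q.2
  linarith [h2.2.2, h3.2.1]

/-- Case 1 of Proposition: if `spt μ ⊂ S(-1,c)`, `spt ν ⊂ S(c,1)`, the measures
give no mass to horizontal slices, and `ε₁, ε₂ > 0` satisfy
`μ[S(-1,-1+ε₁)] = ν[S(c,c+ε₂)] = 1/2`, then
`γ = 2(μ⁻ ⊗ ν⁻ + μ⁺ ⊗ ν⁺)` is a coupling of `μ` and `ν` and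
`|x - y| ≥ min{c+1-ε₁, ε₂} > 0` on `spt γ`. -/
theorem stmt_7 (d : ℕ)
    (μ ν : Measure (EuclideanSpace ℝ (Fin (d + 1))))
    [IsProbabilityMeasure μ] [IsProbabilityMeasure ν]
    (c : ℝ) (hc : c ∈ Set.Ioo (-1 : ℝ) 1)
    (hμslice : ∀ t : ℝ, μ {x | ‖x‖ = 1 ∧ x (Fin.last d) = t} = 0)
    (hνslice : ∀ t : ℝ, ν {x | ‖x‖ = 1 ∧ x (Fin.last d) = t} = 0)
    (hμspt : μ (slab d (-1) c)ᶜ = 0)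
    (hνspt : ν (slab d c 1)ᶜ = 0)
    (ε₁ ε₂ : ℝ) (hε₁ : 0 < ε₁) (hε₂ : 0 < ε₂)
    (hμhalf : μ (slab d (-1) (-1 + ε₁)) = 1 / 2)
    (hνhalf : ν (slab d c (c + ε₂)) = 1 / 2) :
    ∀ γ : Measure (EuclideanSpace ℝ (Fin (d + 1)) × EuclideanSpace ℝ (Fin (d + 1))),
      γ = 2 • ((μ.restrict (slab d (-1) (-1 + ε₁))).prod
                  (ν.restrict (slab d c (c + ε₂))) +
               (μ.restrict (slab d (-1 + ε₁) c)).prod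
                  (ν.restrict (slab d (c + ε₂) 1))) →
      γ.map Prod.fst = μ ∧ γ.map Prod.snd = ν ∧
      0 < min (c + 1 - ε₁) ε₂ ∧
      ∀ p ∈ measSupport γ, min (c + 1 - ε₁) ε₂ ≤ ‖p.1 - p.2‖ := by
  rintro γ rfl
  obtain ⟨hμ, hμ2⟩ := slab_split d μ _ _ _ hμslice hμspt hμhalf
  obtain ⟨hν, hν2⟩ := slab_split d ν _ _ _ hνslice hνspt hνhalf
  have hlt := slab_lt d μ _ _ _ hμspt hμhalf
  have hns : ∀ m : Measure (EuclideanSpace ℝ (Fin (d + 1))),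
      (2 : ℕ) • ((1 / 2 : ENNReal) • m) = m := by
    intro m
    rw [two_nsmul, ← add_smul, ENNReal.add_halves, one_smul]
  refine ⟨?_, ?_, lt_min (by linarith) hε₂, ?_⟩
  · rw [two_nsmul, Measure.map_add _ _ measurable_fst, ← two_nsmul,
      Measure.map_add _ _ measurable_fst, Measure.map_fst_prod, Measure.map_fst_prod,
      Measure.restrict_apply_univ, Measure.restrict_apply_univ, hνhalf, hν2, ← smul_add, hμ, hns]
  · rw [two_nsmul, Measure.map_add _ _ measurable_snd, ← two_nsmul,
      Measure.map_add _ _ measurable_snd, Measure.map_snd_prod, Measure.map_snd_prod,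
      Measure.restrict_apply_univ, Measure.restrict_apply_univ, hμhalf, hμ2, ← smul_add, hν, hns]
  · intro p hp
    by_contra! hlt'
    have := hp {q | ‖q.1 - q.2‖ < min (c + 1 - ε₁) ε₂}
      (isOpen_lt (by fun_prop) continuous_const) hlt'
    rw [two_nsmul, Measure.add_apply, Measure.add_apply,
      slab_prod_null d μ ν _ _ _ _ _ ((min_le_left _ _).trans (by linarith)),
      slab_prod_null d μ ν _ _ _ _ _ ((min_le_right _ _).trans (by linarith))] at this
    simp at this
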